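/- arXiv:1703.06459 — 3 statements merged into one kernel-verified Lean document; each statement's English description precedes it below -/
import Mathlib

section
/- Let X be a compact, locally connected topological space, let Y be a Hausdorff topological space, and let f : X → Y be a continuous surjective map. Then Y is locally connected. -/
/-- The codomain of a quotient map from a locally connected space is locally connected. -/
theorem Topology.IsQuotientMap.locallyConnectedSpace_codomain
    {X Y : Type*} [TopologicalSpace X] [TopologicalSpace Y] [LocallyConnectedSpace X]
    {f : X → Y} (hf : Topology.IsQuotientMap f) : LocallyConnectedSpace Y := by
  refine locallyConnectedSpace_iff_connectedComponentIn_open.2 fun F hF y _ => ?_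
  rw [← hf.isOpen_preimage, isOpen_iff_mem_nhds]
  intro x hx
  have hxF : f x ∈ F := connectedComponentIn_subset F y hx
  refine Filter.mem_of_superset
    (connectedComponentIn_mem_nhds ((hF.preimage hf.continuous).mem_nhds hxF)) ?_
  rw [connectedComponentIn_eq hx, ← Set.image_subset_iff]
  exact (isPreconnected_connectedComponentIn.image f
    hf.continuous.continuousOn).subset_connectedComponentIn
    (Set.mem_image_of_mem f (mem_connectedComponentIn hxF))
    (Set.image_subset_iff.2 (connectedComponentIn_subset _ _))

/-- If `f : X → Y` is a continuous surjection from a compact, locally connected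
space onto a Hausdorff space, then `Y` is locally connected. -/
theorem continuous_surj_image_locallyConnected
    {X Y : Type*} [TopologicalSpace X] [TopologicalSpace Y]
    [CompactSpace X] [LocallyConnectedSpace X] [T2Space Y]
    (f : X → Y) (hf : Continuous f) (hsurj : Function.Surjective f) :
    LocallyConnectedSpace Y :=
  (hf.isClosedMap.isQuotientMap hf hsurj).locallyConnectedSpace_codomain
end

section
/- (Brjuno's theorem.) Let θ ∈ (0,1) be irrational with Φ(θ) < ∞. Let U ⊆ ℂ be open, z₀ ∈ U, and let f : U → ℂ be holomorphic with f(z₀) = z₀ and f'(z₀) = e^{2πiθ}. Then f is linearizable at z₀: there exist ρ > 0 and an injective holomorphic map φ : B(0,ρ) → U with φ(0) = z₀ such that f(φ(z)) = φ(e^{2πiθ}z) for all z ∈ B(0,ρ). (The paper states this for a periodic point z₀ of period p of an analytic map R; that case is obtained by taking f = R^p.) -/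
open Complex Real

/-- The sequence of iterated Gauss-map images of `θ` (indexed from `0`, so
`brjunoSeq θ n` is `θ_{n+1}` in the usual notation: `θ₁ = θ`,
`θ_{n+1} = {1/θ_n}`). -/
noncomputable def brjunoSeq (θ : ℝ) : ℕ → ℝ
  | 0 => θ
  | n + 1 => Int.fract (1 / brjunoSeq θ n)

/-- The terms of the Brjuno series: `θ₁θ₂⋯θ_{n-1} log(1/θ_n)`. -/
noncomputable def brjunoTerm (θ : ℝ) (n : ℕ) : ℝ :=
  (∏ k ∈ Finset.range n, brjunoSeq θ k) * Real.log (1 / brjunoSeq θ n)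

/-- `Φ(θ) < ∞`: the Brjuno series converges. -/
def IsBrjuno (θ : ℝ) : Prop := Summable (brjunoTerm θ)

theorem exists_superadditive_of_spaced (S : Set ℕ) (m : ℝ) (hm : 0 < m)
    (hmin : ∀ s ∈ S, m ≤ s) (hgap : ∀ s ∈ S, ∀ t ∈ S, s < t → m ≤ (t : ℝ) - s) :
    ∃ g : ℕ → ℝ, (∀ a, 0 ≤ g a) ∧ (∀ a, g a ≤ 2 * a / m) ∧ Monotone g ∧
      (∀ a b, g a + g b ≤ g (a + b)) ∧ ∀ s, s + 1 ∈ S → g s + 1 ≤ g (s + 1) := by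
  classical
  let B : ℕ → ℝ := fun a => 2 * a / m - 1
  let t : ℕ → ℕ → ℝ := fun a s => if s ∈ S ∧ a < s then min (B a) (B s - 1) else B a
  let g : ℕ → ℝ := fun a => if (a : ℝ) < m then 0 else ⨅ s, t a s
  have hBmono : ∀ a b : ℕ, a ≤ b → B a ≤ B b := by
    intro a b hab
    have : (a : ℝ) ≤ b := by exact_mod_cast hab
    simp only [B]; gcongr
  have hB1 : ∀ a : ℕ, m ≤ a → 1 ≤ B a := by
    intro a ha
    simp only [B]
    rw [le_sub_iff_add_le, le_div_iff₀ hm]; linarith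
  have htB : ∀ a s, t a s ≤ B a := by
    intro a s; simp only [t]; split_ifs
    · exact min_le_left _ _
    · exact le_rfl
  have ht0 : ∀ a s : ℕ, m ≤ a → 0 ≤ t a s := by
    intro a s ha
    have h1 := hB1 a ha
    simp only [t]; split_ifs with h
    · have := hBmono a s h.2.le
      exact le_min (by linarith) (by linarith)
    · linarith
  have hbdd : ∀ a : ℕ, m ≤ a → BddBelow (Set.range (t a)) := by
    intro a ha
    exact ⟨0, by rintro _ ⟨s, rfl⟩; exact ht0 a s ha⟩
  have gsmall : ∀ a : ℕ, (a : ℝ) < m → g a = 0 := fun a ha => if_pos ha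
  have gbig : ∀ a : ℕ, m ≤ a → g a = ⨅ s, t a s := fun a ha => if_neg (not_lt.2 ha)
  have gle : ∀ a s : ℕ, m ≤ a → g a ≤ t a s := by
    intro a s ha; rw [gbig a ha]; exact ciInf_le (hbdd a ha) s
  have g0 : ∀ a, 0 ≤ g a := by
    intro a
    rcases lt_or_ge (a : ℝ) m with h | h
    · rw [gsmall a h]
    · rw [gbig a h]; exact le_ciInf fun s => ht0 a s h
  have gB : ∀ a : ℕ, m ≤ a → g a ≤ B a := fun a ha => (gle a 0 ha).trans (htB a 0)
  have gmono : Monotone g := by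
    intro a b hab
    have hab' : (a : ℝ) ≤ b := by exact_mod_cast hab
    rcases lt_or_ge (a : ℝ) m with h | h
    · rw [gsmall a h]; exact g0 b
    · rw [gbig b (h.trans hab')]
      refine le_ciInf fun s => (gle a s h).trans ?_
      by_cases hs : s ∈ S ∧ b < s
      · have hs' : s ∈ S ∧ a < s := ⟨hs.1, hab.trans_lt hs.2⟩
        simp only [t, if_pos hs, if_pos hs']
        exact min_le_min_right _ (hBmono a b hab)
      · have : t b s = B b := by simp only [t, if_neg hs]
        rw [this]; exact (htB a s).trans (hBmono a b hab)
  refine ⟨g, g0, ?_, gmono, ?_, ?_⟩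
  · intro a
    rcases lt_or_ge (a : ℝ) m with h | h
    · rw [gsmall a h]; positivity
    · have := gB a h
      simp only [B] at this; linarith
  · intro a b
    rcases lt_or_ge (a : ℝ) m with h | h
    · rw [gsmall a h, zero_add]; exact gmono (Nat.le_add_left b a)
    rcases lt_or_ge (b : ℝ) m with h' | h'
    · rw [gsmall b h', add_zero]; exact gmono (Nat.le_add_right a b)
    have hab : m ≤ ((a + b : ℕ) : ℝ) := by push_cast; linarith
    have key : g a + g b ≤ B (a + b) - 1 := by
      have h1 := gB a h
      have h2 := gB b h'
      have : B a + B b = B (a + b) - 1 := by simp only [B]; push_cast; ring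
      linarith
    rw [gbig _ hab]
    refine le_ciInf fun s => ?_
    simp only [t]; split_ifs with hs
    · have := hBmono _ _ hs.2.le
      exact le_min (by linarith) (by linarith)
    · linarith
  · intro s hs
    have hsm := hmin _ hs
    have key : g s + 1 ≤ B (s + 1) := by
      rcases lt_or_ge (s : ℝ) m with h | h
      · rw [gsmall s h, zero_add]; exact hB1 _ hsm
      · have h1 := gle s (s + 1) h
        have h2 : t s (s + 1) ≤ B (s + 1) - 1 := by
          simp only [t, if_pos (show s + 1 ∈ S ∧ s < s + 1 from ⟨hs, Nat.lt_succ_self s⟩)]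
          exact min_le_right _ _
        linarith
    rw [gbig _ hsm]
    refine le_ciInf fun s' => ?_
    simp only [t]; split_ifs with hs'
    · refine le_min key ?_
      have hg := hgap _ hs _ hs'.1 hs'.2
      have : B (s + 1) + 2 ≤ B s' := by
        simp only [B]
        have : (2 : ℝ) * ((s + 1 : ℕ) : ℝ) / m + 2 ≤ 2 * s' / m := by
          rw [div_add' _ _ _ hm.ne', div_le_div_iff_of_pos_right hm]; linarith
        linarith
      linarith
    · exact key

/-- The product `θ₁⋯θₙ`. -/
noncomputable def brjunoProd (θ : ℝ) (n : ℕ) : ℝ :=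
  ∏ k ∈ Finset.range n, brjunoSeq θ k

theorem brjunoSeq_irrational {θ : ℝ} (hirr : Irrational θ) (n : ℕ) :
    Irrational (brjunoSeq θ n) := by
  induction n with
  | zero => exact hirr
  | succ n ih =>
    have h : Irrational (1 / brjunoSeq θ n) := by
      rw [one_div]; exact ih.inv
    exact h.sub_intCast _

theorem brjunoSeq_mem_Ioo {θ : ℝ} (hθ : θ ∈ Set.Ioo (0 : ℝ) 1) (hirr : Irrational θ) (n : ℕ) :
    brjunoSeq θ n ∈ Set.Ioo (0 : ℝ) 1 := by
  cases n with
  | zero => exact hθ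
  | succ n =>
    refine ⟨lt_of_le_of_ne (Int.fract_nonneg _) ?_, Int.fract_lt_one _⟩
    exact (brjunoSeq_irrational hirr (n + 1)).ne_zero.symm

theorem brjunoProd_succ (θ : ℝ) (n : ℕ) :
    brjunoProd θ (n + 1) = brjunoProd θ n * brjunoSeq θ n :=
  Finset.prod_range_succ _ _

theorem brjunoProd_pos {θ : ℝ} (hθ : θ ∈ Set.Ioo (0 : ℝ) 1) (hirr : Irrational θ) (n : ℕ) :
    0 < brjunoProd θ n :=
  Finset.prod_pos fun k _ => (brjunoSeq_mem_Ioo hθ hirr k).1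

theorem brjunoProd_le_one {θ : ℝ} (hθ : θ ∈ Set.Ioo (0 : ℝ) 1) (hirr : Irrational θ) (n : ℕ) :
    brjunoProd θ n ≤ 1 :=
  Finset.prod_le_one (fun k _ => (brjunoSeq_mem_Ioo hθ hirr k).1.le)
    fun k _ => (brjunoSeq_mem_Ioo hθ hirr k).2.le

/-- The recursion `β_{n+2} = β_n - a_n β_{n+1}` with integer partial quotient `a_n ≥ 1`. -/
theorem brjunoProd_add_two {θ : ℝ} (hθ : θ ∈ Set.Ioo (0 : ℝ) 1) (hirr : Irrational θ) (n : ℕ) :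
    ∃ a : ℤ, 1 ≤ a ∧ brjunoProd θ (n + 2) = brjunoProd θ n - a * brjunoProd θ (n + 1) := by
  have h := brjunoSeq_mem_Ioo hθ hirr n
  refine ⟨⌊1 / brjunoSeq θ n⌋, ?_, ?_⟩
  · rw [Int.le_floor, Int.cast_one, le_div_iff₀ h.1]; linarith [h.2]
  · rw [brjunoProd_succ, brjunoProd_succ]
    have : brjunoSeq θ (n + 1) = 1 / brjunoSeq θ n - ⌊1 / brjunoSeq θ n⌋ := rfl
    rw [this]
    have := h.1.ne'
    field_simp

theorem brjunoProd_le_geometric {θ : ℝ} (hθ : θ ∈ Set.Ioo (0 : ℝ) 1) (hirr : Irrational θ)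
    (n : ℕ) : brjunoProd θ n ≤ (2 * (7 / 8) ^ n) ^ 2 := by
  induction n using Nat.twoStepInduction with
  | zero => norm_num [brjunoProd]
  | one => exact (brjunoProd_le_one hθ hirr 1).trans (by norm_num)
  | more n h _ =>
    obtain ⟨a, ha, hrec⟩ := brjunoProd_add_two hθ hirr n
    have h1 := brjunoProd_pos hθ hirr (n + 1)
    have ha' : (1 : ℝ) ≤ a := by exact_mod_cast ha
    have h2 : brjunoProd θ (n + 2) ≤ brjunoProd θ n - brjunoProd θ (n + 1) := by
      rw [hrec]; nlinarith
    have h3 : brjunoProd θ (n + 2) ≤ brjunoProd θ (n + 1) := by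
      rw [brjunoProd_succ θ (n + 1)]
      exact mul_le_of_le_one_right h1.le (brjunoSeq_mem_Ioo hθ hirr (n + 1)).2.le
    have h4 : (2 * (7 / 8 : ℝ) ^ (n + 2)) ^ 2 = (2 * (7 / 8) ^ n) ^ 2 * (7 / 8) ^ 4 := by ring
    rw [h4]
    have : 0 < (2 * (7 / 8 : ℝ) ^ n) ^ 2 := by positivity
    norm_num at this ⊢
    nlinarith

theorem exists_convergents {θ : ℝ} (hθ : θ ∈ Set.Ioo (0 : ℝ) 1) (hirr : Irrational θ) (n : ℕ) :
    ∃ q q' p p' s : ℤ, s * s = 1 ∧ 0 ≤ q ∧ q ≤ q' ∧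
      (q' : ℝ) * brjunoProd θ n + q * brjunoProd θ (n + 1) = 1 ∧
      q * θ - p = s * brjunoProd θ n ∧ q' * θ - p' = -s * brjunoProd θ (n + 1) := by
  induction n with
  | zero => exact ⟨0, 1, 1, 0, -1, by norm_num [brjunoProd, brjunoSeq]⟩
  | succ n ih =>
    obtain ⟨q, q', p, p', s, hs, hq, hqq, h1, h2, h3⟩ := ih
    obtain ⟨a, ha, hrec⟩ := brjunoProd_add_two hθ hirr n
    refine ⟨q', a * q' + q, p', a * p' + p, -s, by linarith, by linarith, by nlinarith, ?_, ?_, ?_⟩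
    · rw [hrec]; push_cast; linear_combination h1
    · push_cast; exact h3
    · rw [hrec]; push_cast; linear_combination a * h3 + h2

/-- Good rational approximations need large denominators. -/
theorem one_le_of_abs_mul_sub_lt {θ : ℝ} (hθ : θ ∈ Set.Ioo (0 : ℝ) 1) (hirr : Irrational θ)
    (n : ℕ) (a : ℕ) (ha : 0 < a) (x : ℤ) (h : |a * θ - x| < brjunoProd θ n / 2) :
    1 ≤ 2 * a * brjunoProd θ n := by
  obtain ⟨q, q', p, p', s, hs, hq, hqq, h1, h2, h3⟩ := exists_convergents hθ hirr n
  have hb := brjunoProd_pos hθ hirr n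
  have hb' := brjunoProd_pos hθ hirr (n + 1)
  have hs' : (s : ℝ) * s = 1 := by exact_mod_cast hs
  have habs : |(s : ℝ)| = 1 := by
    rcases mul_self_eq_one_iff.1 hs' with h | h <;> simp [h]
  have hqR : (0 : ℝ) ≤ q := by exact_mod_cast hq
  have hqqR : (q : ℝ) ≤ q' := by exact_mod_cast hqq
  have hdet : p * q' - p' * q = -s := by
    have : (p : ℝ) * q' - p' * q = -s := by
      linear_combination q * h3 - q' * h2 - s * h1
    exact_mod_cast this
  have haR : (0 : ℝ) < a := by exact_mod_cast ha
  by_cases hd : (a : ℤ) * p - x * q = 0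
  · exfalso
    set j : ℤ := -s * (x * q' - a * p') with hj
    have hja : (a : ℤ) = j * q := by
      rw [hj]; linear_combination (-a) * hs + s * a * hdet - s * q' * hd
    have hjx : x = j * p := by
      rw [hj]; linear_combination (-x) * hs + s * x * hdet - s * p' * hd
    have hj0 : j ≠ 0 := by
      rintro h0; rw [h0] at hja; omega
    have e1 : (a : ℝ) * θ - x = j * (s * brjunoProd θ n) := by
      have e2 : (a : ℝ) = j * q := by exact_mod_cast hja
      have e3 : (x : ℝ) = j * p := by exact_mod_cast hjx
      rw [e2, e3]; linear_combination j * h2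
    rw [e1, abs_mul, abs_mul, habs, one_mul, abs_of_pos hb] at h
    have : (1 : ℝ) ≤ |(j : ℝ)| := by exact_mod_cast Int.one_le_abs hj0
    nlinarith
  · have e : ((a : ℤ) * p - x * q : ℤ) = -(a * (s * brjunoProd θ n)) + q * (a * θ - x) := by
      push_cast; linear_combination (-a) * h2
    have h4 : (1 : ℝ) ≤ |(((a : ℤ) * p - x * q : ℤ) : ℝ)| := by exact_mod_cast Int.one_le_abs hd
    rw [e] at h4
    have h5 := h4.trans (abs_add_le _ _)
    rw [abs_neg, abs_mul, abs_mul, abs_mul, habs, one_mul, abs_of_pos hb, abs_of_pos haR,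
      abs_of_nonneg hqR] at h5
    have h6 : q * |a * θ - x| ≤ q * (brjunoProd θ n / 2) := by gcongr
    nlinarith

theorem le_norm_rotation_pow_sub_one (θ : ℝ) (a : ℕ) (d : ℝ)
    (h : ∀ x : ℤ, d / 4 ≤ |a * θ - x|) :
    d ≤ ‖Complex.exp (2 * Real.pi * Complex.I * θ) ^ a - 1‖ := by
  set x := round (a * θ) with hx
  set y : ℝ := a * θ - x with hy
  have hy2 : |y| ≤ 1 / 2 := abs_sub_round _
  have e : Complex.exp (2 * Real.pi * Complex.I * θ) ^ a
      = Complex.exp (Complex.I * ((2 * Real.pi * y : ℝ) : ℂ)) := by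
    rw [← Complex.exp_nat_mul, Complex.exp_eq_exp_iff_exists_int]
    refine ⟨x, ?_⟩
    rw [hy]; push_cast; ring
  rw [e, Complex.norm_exp_I_mul_ofReal_sub_one]
  have h1 : 2 * Real.pi * y / 2 = Real.pi * y := by ring
  rw [h1, Real.norm_eq_abs, abs_mul, abs_two]
  have h2 : 2 * |y| ≤ |Real.sin (Real.pi * y)| := by
    have h3 := Real.mul_abs_le_abs_sin (x := Real.pi * y) (by
      rw [abs_mul, abs_of_pos Real.pi_pos]; nlinarith [Real.pi_pos])
    rw [abs_mul, abs_of_pos Real.pi_pos] at h3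
    calc 2 * |y| = 2 / Real.pi * (Real.pi * |y|) := by field_simp
      _ ≤ _ := h3
  linarith [h x]

theorem summable_brjunoProd_mul_log {θ : ℝ} (hθ : θ ∈ Set.Ioo (0 : ℝ) 1) (hirr : Irrational θ)
    (hB : IsBrjuno θ) :
    Summable fun k => brjunoProd θ k * Real.log (1 / brjunoProd θ (k + 1)) := by
  have hgeo : Summable fun k : ℕ => 2 * (2 * (7 / 8 : ℝ) ^ k) :=
    ((summable_geometric_of_lt_one (by norm_num) (by norm_num)).mul_left 2).mul_left 2
  have h2 : Summable fun k => brjunoProd θ k * Real.log (1 / brjunoProd θ k) := by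
    refine Summable.of_nonneg_of_le (fun k => ?_) (fun k => ?_) hgeo
    · have hb := brjunoProd_pos hθ hirr k
      exact mul_nonneg hb.le (Real.log_nonneg (by
        rw [le_div_iff₀ hb]; linarith [brjunoProd_le_one hθ hirr k]))
    · have hb := brjunoProd_pos hθ hirr k
      set b := brjunoProd θ k
      have hs : 0 < √b := Real.sqrt_pos.2 hb
      have hsq : √b * √b = b := Real.mul_self_sqrt hb.le
      have e : Real.log (1 / b) = 2 * Real.log (1 / √b) := by
        rw [one_div, one_div, Real.log_inv, Real.log_inv, Real.log_sqrt hb.le]; ring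
      have h3 : Real.log (1 / √b) ≤ 1 / √b := (Real.log_le_sub_one_of_pos (by positivity)).trans
        (by linarith)
      have h4 : √b ≤ 2 * (7 / 8 : ℝ) ^ k :=
        Real.sqrt_le_iff.2 ⟨by positivity, brjunoProd_le_geometric hθ hirr k⟩
      calc b * Real.log (1 / b) ≤ b * (2 * (1 / √b)) := by rw [e]; gcongr
        _ = 2 * √b := by
            nth_rewrite 1 [← hsq]; field_simp
        _ ≤ _ := by gcongr
  refine (Summable.add hB h2).congr fun k => ?_
  have hb := (brjunoProd_pos hθ hirr k).ne'
  have ht := (brjunoSeq_mem_Ioo hθ hirr k).1.ne'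
  change brjunoProd θ k * _ + _ = _
  rw [brjunoProd_succ, one_div, one_div, one_div, Real.log_inv, Real.log_inv, Real.log_inv,
    Real.log_mul hb ht]
  ring

/-- Control of the small divisors `λ^n - 1` of a Brjuno rotation by a superadditive function of
linear growth. -/
theorem exists_superadditive_small_divisor {θ : ℝ} (hθ : θ ∈ Set.Ioo (0 : ℝ) 1)
    (hirr : Irrational θ) (hB : IsBrjuno θ) :
    ∃ (K : ℕ → ℝ) (C : ℝ), (∀ a, 0 ≤ K a) ∧ (∀ a, K a ≤ C * a) ∧
      (∀ a b, K a + K b ≤ K (a + b)) ∧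
      ∀ a, Real.exp (K a - K (a + 1)) ≤
        ‖Complex.exp (2 * Real.pi * Complex.I * θ) ^ (a + 1) - 1‖ := by
  let b := brjunoProd θ
  have hb : ∀ k, 0 < b k := brjunoProd_pos hθ hirr
  let S : ℕ → Set ℕ := fun k => {a | 0 < a ∧ ∃ x : ℤ, |a * θ - x| < b k / 4}
  have hg : ∀ k, ∃ g : ℕ → ℝ, (∀ a, 0 ≤ g a) ∧ (∀ a, g a ≤ 2 * a / (1 / (2 * b k))) ∧
      Monotone g ∧ (∀ a b, g a + g b ≤ g (a + b)) ∧ ∀ s, s + 1 ∈ S k → g s + 1 ≤ g (s + 1) := by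
    intro k
    have hbk := hb k
    apply exists_superadditive_of_spaced _ _ (by positivity)
    · rintro s ⟨hs, x, hx⟩
      have := one_le_of_abs_mul_sub_lt hθ hirr k s hs x (hx.trans (by change b k / 4 < b k / 2; linarith))
      rw [div_le_iff₀ (by positivity)]
      change 1 ≤ 2 * s * b k at this
      linarith
    · rintro s ⟨hs, x, hx⟩ t ⟨ht, y, hy⟩ hst
      have := one_le_of_abs_mul_sub_lt hθ hirr k (t - s) (by omega) (y - x) (by
        rw [Nat.cast_sub hst.le]; push_cast
        have e : ((t : ℝ) - s) * θ - (y - x) = (t * θ - y) - (s * θ - x) := by ring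
        rw [e]
        change _ < b k / 2
        linarith [abs_sub (t * θ - y) (s * θ - x)])
      rw [Nat.cast_sub hst.le] at this
      rw [div_le_iff₀ (by positivity)]
      change 1 ≤ 2 * _ * b k at this
      linarith
  choose g g0 gle gmono gadd gjump using hg
  let L : ℕ → ℝ := fun k => Real.log (1 / b (k + 1))
  have hL : ∀ k, 0 ≤ L k := fun k => Real.log_nonneg (by
    rw [le_div_iff₀ (hb _)]; linarith [brjunoProd_le_one hθ hirr (k + 1)])
  have hsum : Summable fun k => b k * L k := summable_brjunoProd_mul_log hθ hirr hB
  have hle : ∀ a k, g k a * L k ≤ (4 * a) * (b k * L k) := by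
    intro a k
    have h1 := gle k a
    have h2 : 2 * (a : ℝ) / (1 / (2 * b k)) = 4 * a * b k := by
      have := (hb k).ne'
      field_simp; ring
    rw [h2] at h1
    calc g k a * L k ≤ (4 * a * b k) * L k := mul_le_mul_of_nonneg_right h1 (hL k)
      _ = _ := by ring
  have hsg : ∀ a, Summable fun k => g k a * L k := fun a =>
    Summable.of_nonneg_of_le (fun k => mul_nonneg (g0 k a) (hL k)) (hle a) (hsum.mul_left _)
  refine ⟨fun a => ∑' k, g k a * L k, 4 * ∑' k, b k * L k,
    fun a => tsum_nonneg fun k => mul_nonneg (g0 k a) (hL k), ?_, ?_, ?_⟩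
  · intro a
    calc _ ≤ ∑' k, (4 * a) * (b k * L k) := (hsg a).tsum_le_tsum (hle a) (hsum.mul_left _)
      _ = _ := by rw [tsum_mul_left]; ring
  · intro a c
    rw [← (hsg a).tsum_add (hsg c)]
    refine ((hsg a).add (hsg c)).tsum_le_tsum (fun k => ?_) (hsg _)
    rw [← add_mul]
    exact mul_le_mul_of_nonneg_right (gadd k a c) (hL k)
  · intro a
    have hmono : ∑' k, g k a * L k ≤ ∑' k, g k (a + 1) * L k :=
      (hsg a).tsum_le_tsum
        (fun k => mul_le_mul_of_nonneg_right (gmono k (Nat.le_succ a)) (hL k)) (hsg _)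
    have hnot : ∀ k, a + 1 ∉ S k →
        b k ≤ ‖Complex.exp (2 * Real.pi * Complex.I * θ) ^ (a + 1) - 1‖ := by
      intro k hk
      apply le_norm_rotation_pow_sub_one
      intro x
      by_contra hx
      exact hk ⟨Nat.succ_pos a, x, not_le.1 hx⟩
    have hex : ∃ k, a + 1 ∉ S k := by
      have hi : Irrational (((a + 1 : ℕ) : ℝ) * θ) := hirr.natCast_mul (Nat.succ_ne_zero a)
      set y := ((a + 1 : ℕ) : ℝ) * θ
      have hd : 0 < |y - round y| := by
        rw [abs_pos, sub_ne_zero]; exact hi.ne_int _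
      have hlim : Filter.Tendsto (fun k : ℕ => (2 * (7 / 8 : ℝ) ^ k) ^ 2) Filter.atTop (nhds 0) := by
        have := ((tendsto_pow_atTop_nhds_zero_of_lt_one (r := (7 / 8 : ℝ)) (by norm_num)
          (by norm_num)).const_mul 2).pow 2
        simpa using this
      obtain ⟨k, hk⟩ := (hlim.eventually (gt_mem_nhds hd)).exists
      refine ⟨k, ?_⟩
      rintro ⟨-, x, hx⟩
      have h1 := round_le y x
      have h2 : b k ≤ _ := brjunoProd_le_geometric hθ hirr k
      have h3 := hb k
      change |y - x| < _ at hx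
      linarith
    classical
    have hk := Nat.find_spec hex
    have hmin := fun j => Nat.find_min hex (m := j)
    set k := Nat.find hex
    rcases k with _ | k
    · calc _ ≤ (1 : ℝ) := Real.exp_le_one_iff.2 (by linarith)
        _ = b 0 := by simp [b, brjunoProd]
        _ ≤ _ := hnot 0 hk
    · have hin : a + 1 ∈ S k := by
        by_contra h; exact hmin k (Nat.lt_succ_self k) h
      have h1 : L k + ∑' k, g k a * L k ≤ ∑' k, g k (a + 1) * L k := by
        have h2 : (∑' i, (g i (a + 1) * L i - g i a * L i)) =
            (∑' k, g k (a + 1) * L k) - ∑' k, g k a * L k := (hsg _).tsum_sub (hsg _)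
        have h3 := ((hsg (a + 1)).sub (hsg a)).le_tsum k (fun j _ => by
          rw [← sub_mul]
          exact mul_nonneg (sub_nonneg.2 (gmono j (Nat.le_succ a))) (hL j))
        rw [h2] at h3
        have h4 := mul_le_mul_of_nonneg_right (gjump k a hin) (hL k)
        linarith
      calc _ ≤ Real.exp (-L k) := Real.exp_le_exp.2 (by linarith)
        _ = b (k + 1) := by
            simp only [L]
            rw [one_div, Real.log_inv, neg_neg, Real.exp_log (hb _)]
        _ ≤ _ := hnot _ hk

theorem coeff_pow_congr {R : Type*} [CommSemiring R] {w w' : PowerSeries R} {n : ℕ}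
    (h : ∀ b ≤ n, PowerSeries.coeff b w = PowerSeries.coeff b w') (k : ℕ) :
    ∀ b ≤ n, PowerSeries.coeff b (w ^ k) = PowerSeries.coeff b (w' ^ k) := by
  induction k with
  | zero => simp
  | succ k ih =>
    intro b hb
    rw [pow_succ, pow_succ, PowerSeries.coeff_mul, PowerSeries.coeff_mul]
    refine Finset.sum_congr rfl fun p hp => ?_
    have := Finset.HasAntidiagonal.mem_antidiagonal.1 hp
    rw [ih p.1 (by omega), h p.2 (by omega)]

/-- The coefficients of the solution of the formal linearization equation. -/
noncomputable def linearizationCoeff (c F : ℕ → ℂ) : ℕ → ℂ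
  | 0 => 1
  | a + 1 => c a * ∑ p ∈ Finset.HasAntidiagonal.antidiagonal a, F p.1 *
      PowerSeries.coeff p.2 ((PowerSeries.mk fun b =>
        if _ : b < a + 1 then linearizationCoeff c F b else 0) ^ (p.1 + 2))

theorem exists_formal_linearization (c F : ℕ → ℂ) :
    ∃ w : PowerSeries ℂ, PowerSeries.coeff 0 w = 1 ∧
      ∀ a, PowerSeries.coeff (a + 1) w = c a * ∑ p ∈ Finset.HasAntidiagonal.antidiagonal a, F p.1 *
        PowerSeries.coeff p.2 (w ^ (p.1 + 2)) := by
  refine ⟨PowerSeries.mk (linearizationCoeff c F), ?_, fun a => ?_⟩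
  · rw [PowerSeries.coeff_mk, linearizationCoeff]
  · rw [PowerSeries.coeff_mk, linearizationCoeff]
    congr 1
    refine Finset.sum_congr rfl fun p hp => ?_
    have := Finset.HasAntidiagonal.mem_antidiagonal.1 hp
    congr 1
    refine coeff_pow_congr (n := a) (fun b hb => ?_) _ _ (by omega)
    rw [PowerSeries.coeff_mk, PowerSeries.coeff_mk, dif_pos (by omega)]

theorem norm_coeff_pow_mul_le {w : PowerSeries ℂ} {v : PowerSeries ℝ} {κ : ℕ → ℝ}
    (hκ : ∀ a, 0 ≤ κ a) (hκ0 : κ 0 ≤ 1) (hκadd : ∀ a b, κ (a + b) ≤ κ a * κ b)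
    (h : ∀ b, ‖PowerSeries.coeff b w‖ * κ b ≤ PowerSeries.coeff b v) (k : ℕ) :
    ∀ b, ‖PowerSeries.coeff b (w ^ k)‖ * κ b ≤ PowerSeries.coeff b (v ^ k) := by
  induction k with
  | zero =>
    intro b
    rw [pow_zero, pow_zero, PowerSeries.coeff_one, PowerSeries.coeff_one]
    split_ifs with hb
    · simpa [hb] using hκ0
    · simp
  | succ k ih =>
    intro b
    rw [pow_succ, pow_succ, PowerSeries.coeff_mul, PowerSeries.coeff_mul]
    calc _ ≤ (∑ p ∈ Finset.HasAntidiagonal.antidiagonal b,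
          ‖PowerSeries.coeff p.1 (w ^ k) * PowerSeries.coeff p.2 w‖) * κ b :=
          mul_le_mul_of_nonneg_right (norm_sum_le _ _) (hκ b)
      _ = ∑ p ∈ Finset.HasAntidiagonal.antidiagonal b,
          ‖PowerSeries.coeff p.1 (w ^ k) * PowerSeries.coeff p.2 w‖ * κ b := Finset.sum_mul _ _ _
      _ ≤ _ := by
        refine Finset.sum_le_sum fun p hp => ?_
        rw [← Finset.HasAntidiagonal.mem_antidiagonal.1 hp, norm_mul]
        calc _ ≤ ‖PowerSeries.coeff p.1 (w ^ k)‖ * ‖PowerSeries.coeff p.2 w‖ *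
              (κ p.1 * κ p.2) := by gcongr; exact hκadd _ _
          _ = (‖PowerSeries.coeff p.1 (w ^ k)‖ * κ p.1) *
              (‖PowerSeries.coeff p.2 w‖ * κ p.2) := by ring
          _ ≤ _ := mul_le_mul (ih _) (h _) (mul_nonneg (norm_nonneg _) (hκ _))
              ((mul_nonneg (norm_nonneg _) (hκ _)).trans (ih _))

theorem coeff_pow_nonneg {v : PowerSeries ℝ} (hv : ∀ b, 0 ≤ PowerSeries.coeff b v) (k : ℕ) :
    ∀ b, 0 ≤ PowerSeries.coeff b (v ^ k) := by
  induction k with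
  | zero => intro b; rw [pow_zero, PowerSeries.coeff_one]; split_ifs <;> norm_num
  | succ k ih =>
    intro b
    rw [pow_succ, PowerSeries.coeff_mul]
    exact Finset.sum_nonneg fun p _ => mul_nonneg (ih _) (hv _)

theorem sum_range_sum_antidiagonal_le (N : ℕ) (G : ℕ → ℕ → ℝ) (hG : ∀ a b, 0 ≤ G a b) :
    ∑ a ∈ Finset.range N, ∑ p ∈ Finset.HasAntidiagonal.antidiagonal a, G p.1 p.2 ≤
      ∑ a ∈ Finset.range N, ∑ b ∈ Finset.range N, G a b := by
  rw [← Finset.sum_product', Finset.sum_sigma']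
  refine (Finset.sum_image (s := (Finset.range N).sigma fun a => Finset.HasAntidiagonal.antidiagonal a)
    (g := fun x : (_ : ℕ) × (ℕ × ℕ) => x.2) (f := fun p : ℕ × ℕ => G p.1 p.2) ?_).symm.trans_le ?_
  · rintro ⟨a, p⟩ hx ⟨a', p'⟩ hy hxy
    simp only [Finset.coe_sigma, Set.mem_sigma_iff, Finset.mem_coe, Finset.HasAntidiagonal.mem_antidiagonal]
      at hx hy hxy
    subst hxy
    obtain rfl : a = a' := hx.2.symm.trans hy.2
    rfl
  · refine Finset.sum_le_sum_of_subset_of_nonneg ?_ fun p _ _ => hG _ _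
    intro p hp
    simp only [Finset.mem_image, Finset.mem_sigma, Finset.mem_range, Finset.HasAntidiagonal.mem_antidiagonal,
      Finset.mem_product] at hp ⊢
    obtain ⟨⟨a, q⟩, ⟨h1, h2⟩, rfl⟩ := hp
    simp only at h1 h2 ⊢
    omega

theorem sum_coeff_pow_le {v : PowerSeries ℝ} (hv : ∀ b, 0 ≤ PowerSeries.coeff b v) (N k : ℕ) :
    ∑ b ∈ Finset.range N, PowerSeries.coeff b (v ^ k) ≤
      (∑ b ∈ Finset.range N, PowerSeries.coeff b v) ^ k := by
  induction k with
  | zero =>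
    simp only [pow_zero, PowerSeries.coeff_one]
    rw [Finset.sum_ite_eq']
    split_ifs <;> norm_num
  | succ k ih =>
    simp only [pow_succ, PowerSeries.coeff_mul]
    refine (sum_range_sum_antidiagonal_le N (fun a b => PowerSeries.coeff a (v ^ k) *
      PowerSeries.coeff b v) fun a b => mul_nonneg (coeff_pow_nonneg hv k a) (hv b)).trans ?_
    rw [← Finset.sum_mul_sum]
    exact mul_le_mul_of_nonneg_right ih (Finset.sum_nonneg fun b _ => hv b)

/-- The majorant estimate for the solution of the formal linearization equation. -/
theorem norm_linearization_mul_le {c F : ℕ → ℂ} {w : PowerSeries ℂ} {κ : ℕ → ℝ} {A r : ℝ}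
    (hA : 0 < A) (hr : 0 < r) (hAr : 8 * (A * r) ≤ 1) (hF : ∀ j, ‖F j‖ ≤ A ^ (j + 1))
    (hκ : ∀ a, 0 ≤ κ a) (hκadd : ∀ a b, κ (a + b) ≤ κ a * κ b) (hκr : ∀ a, κ a ≤ r ^ a)
    (hc : ∀ a, ‖c a‖ * κ (a + 1) ≤ r * κ a)
    (hw0 : PowerSeries.coeff 0 w = 1)
    (hw : ∀ a, PowerSeries.coeff (a + 1) w = c a * ∑ p ∈ Finset.HasAntidiagonal.antidiagonal a, F p.1 *
        PowerSeries.coeff p.2 (w ^ (p.1 + 2))) (a : ℕ) :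
    ‖PowerSeries.coeff a w‖ * κ a ≤ 2 := by
  have hκ0 : κ 0 ≤ 1 := by simpa using hκr 0
  set v : PowerSeries ℝ := PowerSeries.mk fun a => ‖PowerSeries.coeff a w‖ * κ a with hv
  have hvc : ∀ b, PowerSeries.coeff b v = ‖PowerSeries.coeff b w‖ * κ b := fun b =>
    PowerSeries.coeff_mk _ _
  have hv0 : ∀ b, 0 ≤ PowerSeries.coeff b v := fun b => by
    rw [hvc]; exact mul_nonneg (norm_nonneg _) (hκ b)
  have hwv := norm_coeff_pow_mul_le (w := w) (v := v) hκ hκ0 hκadd fun b => (hvc b).ge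
  have hstep : ∀ a, PowerSeries.coeff (a + 1) v ≤ ∑ p ∈ Finset.HasAntidiagonal.antidiagonal a,
      (A * r) ^ (p.1 + 1) * PowerSeries.coeff p.2 (v ^ (p.1 + 2)) := by
    intro a
    rw [hvc, hw, norm_mul]
    calc _ = (‖c a‖ * κ (a + 1)) * ‖∑ p ∈ Finset.HasAntidiagonal.antidiagonal a, F p.1 *
            PowerSeries.coeff p.2 (w ^ (p.1 + 2))‖ := by ring
      _ ≤ (r * κ a) * ∑ p ∈ Finset.HasAntidiagonal.antidiagonal a, ‖F p.1 *
            PowerSeries.coeff p.2 (w ^ (p.1 + 2))‖ :=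
          mul_le_mul (hc a) (norm_sum_le _ _) (norm_nonneg _) (mul_nonneg hr.le (hκ a))
      _ = ∑ p ∈ Finset.HasAntidiagonal.antidiagonal a, (r * κ a) * ‖F p.1 *
            PowerSeries.coeff p.2 (w ^ (p.1 + 2))‖ := Finset.mul_sum _ _ _
      _ ≤ _ := by
        refine Finset.sum_le_sum fun p hp => ?_
        rw [norm_mul, ← Finset.HasAntidiagonal.mem_antidiagonal.1 hp]
        have h1 : κ (p.1 + p.2) ≤ r ^ p.1 * κ p.2 :=
          (hκadd _ _).trans (mul_le_mul_of_nonneg_right (hκr _) (hκ _))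
        calc _ ≤ (r * (r ^ p.1 * κ p.2)) *
              (A ^ (p.1 + 1) * ‖PowerSeries.coeff p.2 (w ^ (p.1 + 2))‖) := by
                gcongr
                · exact mul_nonneg hr.le (mul_nonneg (pow_nonneg hr.le _) (hκ _))
                · exact hF _
          _ = (A * r) ^ (p.1 + 1) * (‖PowerSeries.coeff p.2 (w ^ (p.1 + 2))‖ * κ p.2) := by
                ring
          _ ≤ _ := mul_le_mul_of_nonneg_left (hwv _ _) (by positivity)
  have hsum : ∀ N, ∑ a ∈ Finset.range N, PowerSeries.coeff a v ≤ 2 := by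
    intro N
    induction N with
    | zero => simp
    | succ N ih =>
      set T := ∑ a ∈ Finset.range N, PowerSeries.coeff a v with hT
      have hT0 : 0 ≤ T := Finset.sum_nonneg fun b _ => hv0 b
      rw [Finset.sum_range_succ']
      have h0 : PowerSeries.coeff 0 v ≤ 1 := by
        rw [hvc, hw0, norm_one, one_mul]; exact hκ0
      have h1 : ∑ a ∈ Finset.range N, PowerSeries.coeff (a + 1) v ≤ 1 := by
        calc _ ≤ ∑ a ∈ Finset.range N, ∑ p ∈ Finset.HasAntidiagonal.antidiagonal a,
              (A * r) ^ (p.1 + 1) * PowerSeries.coeff p.2 (v ^ (p.1 + 2)) :=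
              Finset.sum_le_sum fun a _ => hstep a
          _ ≤ ∑ j ∈ Finset.range N, ∑ b ∈ Finset.range N,
              (A * r) ^ (j + 1) * PowerSeries.coeff b (v ^ (j + 2)) :=
              sum_range_sum_antidiagonal_le N
                (fun j b => (A * r) ^ (j + 1) * PowerSeries.coeff b (v ^ (j + 2)))
                fun j b => mul_nonneg (by positivity) (coeff_pow_nonneg hv0 _ _)
          _ ≤ ∑ j ∈ Finset.range N, (1 / 2 : ℝ) * (1 / 2) ^ j := by
              refine Finset.sum_le_sum fun j _ => ?_
              rw [← Finset.mul_sum]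
              calc _ ≤ (1 / 8 : ℝ) ^ (j + 1) * 2 ^ (j + 2) := by
                    gcongr
                    · exact Finset.sum_nonneg fun b _ => coeff_pow_nonneg hv0 _ _
                    · linarith
                    · exact (sum_coeff_pow_le hv0 _ _).trans (by gcongr)
                _ = 1 / 2 * (1 / 4 : ℝ) ^ j := by
                    rw [show (1 / 4 : ℝ) = 1 / 8 * 2 by norm_num, mul_pow]; ring
                _ ≤ _ := by gcongr; norm_num
          _ ≤ 1 := by
              rw [← Finset.mul_sum, geom_sum_eq (by norm_num)]
              have : (0 : ℝ) < (1 / 2) ^ N := by positivity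
              rw [mul_div_assoc', div_le_iff_of_neg (by norm_num)]
              linarith
      linarith
  calc _ = PowerSeries.coeff a v := (hvc a).symm
    _ ≤ ∑ b ∈ Finset.range (a + 1), PowerSeries.coeff b v :=
        Finset.single_le_sum (fun b _ => hv0 b) (Finset.self_mem_range_succ a)
    _ ≤ 2 := hsum _

/-- Absolute summability, value and norm bound of a Cauchy product. -/
theorem cauchyProduct_summable {f g : ℕ → ℂ} (hf : Summable fun n => ‖f n‖)
    (hg : Summable fun n => ‖g n‖) :
    (Summable fun n => ‖∑ p ∈ Finset.HasAntidiagonal.antidiagonal n, f p.1 * g p.2‖) ∧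
      ∑' n, ∑ p ∈ Finset.HasAntidiagonal.antidiagonal n, f p.1 * g p.2 =
        (∑' n, f n) * ∑' n, g n ∧
      ∑' n, ‖∑ p ∈ Finset.HasAntidiagonal.antidiagonal n, f p.1 * g p.2‖ ≤
        (∑' n, ‖f n‖) * ∑' n, ‖g n‖ := by
  have h1 := summable_norm_sum_mul_antidiagonal_of_summable_norm hf hg
  have hf' : Summable fun n => ‖‖f n‖‖ := by simpa using hf
  have hg' : Summable fun n => ‖‖g n‖‖ := by simpa using hg
  have h2 := (summable_norm_sum_mul_antidiagonal_of_summable_norm hf' hg').of_norm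
  refine ⟨h1, (tsum_mul_tsum_eq_tsum_sum_antidiagonal_of_summable_norm hf hg).symm, ?_⟩
  rw [tsum_mul_tsum_eq_tsum_sum_antidiagonal_of_summable_norm hf' hg']
  refine h1.tsum_le_tsum (fun n => ?_) h2
  simp only [← norm_mul]
  exact norm_sum_le _ _

/-- Summation of `∑ j, d j * z ^ (j + 2) * ∑ b, q j b` along antidiagonals. -/
theorem tsum_mul_tsum_eq_tsum_antidiagonal {d : ℕ → ℂ} {q : ℕ → ℕ → ℂ} {u : ℕ → ℝ}
    (hq : ∀ j, Summable fun b => ‖q j b‖) (hu : Summable u)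
    (hle : ∀ j, ‖d j‖ * ∑' b, ‖q j b‖ ≤ u j) :
    ∑' j, d j * ∑' b, q j b =
      ∑' a, ∑ p ∈ Finset.HasAntidiagonal.antidiagonal a, d p.1 * q p.1 p.2 := by
  have hinner : ∀ j, Summable fun b => d j * q j b := fun j => (hq j).of_norm.mul_left (d j)
  have hP : Summable fun p : ℕ × ℕ => d p.1 * q p.1 p.2 := by
    refine Summable.of_norm ?_
    rw [summable_prod_of_nonneg fun _ => norm_nonneg _]
    simp only [norm_mul, tsum_mul_left]
    refine ⟨fun j => (hq j).mul_left ‖d j‖, ?_⟩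
    exact Summable.of_nonneg_of_le (fun j => mul_nonneg (norm_nonneg _)
      (tsum_nonneg fun _ => norm_nonneg _)) hle hu
  simp only [← tsum_mul_left]
  rw [← hP.tsum_prod' hinner,
    ← Finset.HasAntidiagonal.sigmaAntidiagonalEquivProd.tsum_eq fun p : ℕ × ℕ => d p.1 * q p.1 p.2]
  refine (Summable.tsum_sigma' (fun a => (hasSum_fintype _).summable)
    (Finset.HasAntidiagonal.sigmaAntidiagonalEquivProd.summable_iff.2 hP)).trans ?_
  refine tsum_congr fun a => ?_
  rw [tsum_fintype, Finset.univ_eq_attach]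
  exact Finset.sum_attach (Finset.HasAntidiagonal.antidiagonal a)
    fun p : ℕ × ℕ => d p.1 * q p.1 p.2

theorem tsum_coeff_pow {w : PowerSeries ℂ} {z : ℂ}
    (hs : Summable fun n => ‖PowerSeries.coeff n w * z ^ n‖) (k : ℕ) :
    (Summable fun n => ‖PowerSeries.coeff n (w ^ k) * z ^ n‖) ∧
      ∑' n, PowerSeries.coeff n (w ^ k) * z ^ n = (∑' n, PowerSeries.coeff n w * z ^ n) ^ k ∧
      ∑' n, ‖PowerSeries.coeff n (w ^ k) * z ^ n‖ ≤
        (∑' n, ‖PowerSeries.coeff n w * z ^ n‖) ^ k := by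
  induction k with
  | zero =>
    have h : ∀ n, n ≠ 0 → PowerSeries.coeff n ((w : PowerSeries ℂ) ^ 0) * z ^ n = 0 := by
      intro n hn; simp [PowerSeries.coeff_one, hn]
    refine ⟨?_, ?_, ?_⟩
    · refine summable_of_ne_finset_zero (s := {0}) fun n hn => ?_
      rw [h n (by simpa using hn), norm_zero]
    · rw [tsum_eq_single 0 h]; simp
    · rw [tsum_eq_single 0 fun n hn => by rw [h n hn, norm_zero]]; simp
  | succ k ih =>
    obtain ⟨h1, h2, h3⟩ := ih
    have e : ∀ n, PowerSeries.coeff n (w ^ (k + 1)) * z ^ n = ∑ p ∈ Finset.HasAntidiagonal.antidiagonal n,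
        (PowerSeries.coeff p.1 (w ^ k) * z ^ p.1) * (PowerSeries.coeff p.2 w * z ^ p.2) := by
      intro n
      rw [pow_succ, PowerSeries.coeff_mul, Finset.sum_mul]
      refine Finset.sum_congr rfl fun p hp => ?_
      rw [← Finset.HasAntidiagonal.mem_antidiagonal.1 hp, pow_add]; ring
    obtain ⟨h4, h5, h6⟩ := cauchyProduct_summable h1 hs
    simp only [e]
    refine ⟨h4, ?_, ?_⟩
    · rw [h5, h2, pow_succ]
    · rw [pow_succ]
      exact h6.trans (mul_le_mul_of_nonneg_right h3 (tsum_nonneg fun _ => norm_nonneg _))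

/-- Convergent solutions of the formal linearization equation are genuine solutions. -/
theorem tsum_linearization {lam : ℂ} {F : ℕ → ℂ} {w : PowerSeries ℂ} {A M : ℝ} {z : ℂ}
    (hlam : ‖lam‖ = 1) (hA : 0 < A)
    (hF : ∀ j, ‖F j‖ ≤ A ^ (j + 1))
    (hw : ∀ a, lam * (lam ^ (a + 1) - 1) * PowerSeries.coeff (a + 1) w =
      ∑ p ∈ Finset.HasAntidiagonal.antidiagonal a, F p.1 * PowerSeries.coeff p.2 (w ^ (p.1 + 2)))
    (hs : Summable fun n => ‖PowerSeries.coeff n w * z ^ n‖)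
    (hM : ∑' n, ‖PowerSeries.coeff n w * z ^ n‖ ≤ M) (hz : A * M * ‖z‖ < 1) :
    lam * z * ∑' n, PowerSeries.coeff n w * (lam * z) ^ n =
      lam * (z * ∑' n, PowerSeries.coeff n w * z ^ n) +
        ∑' j, F j * (z * ∑' n, PowerSeries.coeff n w * z ^ n) ^ (j + 2) := by
  have hM0 : 0 ≤ M := (tsum_nonneg fun _ => norm_nonneg _).trans hM
  set W := ∑' n, PowerSeries.coeff n w * z ^ n with hW
  have hR : ∑' j, F j * (z * W) ^ (j + 2) =
      ∑' a, ∑ p ∈ Finset.HasAntidiagonal.antidiagonal a,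
        F p.1 * z ^ (p.1 + 2) * (PowerSeries.coeff p.2 (w ^ (p.1 + 2)) * z ^ p.2) := by
    have hgeo : Summable fun j : ℕ => (M * ‖z‖) * (A * M * ‖z‖) ^ (j + 1) :=
      ((summable_geometric_of_lt_one (by positivity) hz).comp_injective
        (add_left_injective 1)).mul_left _
    rw [← tsum_mul_tsum_eq_tsum_antidiagonal (d := fun j => F j * z ^ (j + 2))
      (q := fun j b => PowerSeries.coeff b (w ^ (j + 2)) * z ^ b)
      (fun j => (tsum_coeff_pow hs (j + 2)).1) hgeo fun j => ?_]
    · refine tsum_congr fun j => ?_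
      rw [(tsum_coeff_pow hs (j + 2)).2.1, mul_pow, mul_assoc]
    · calc _ ≤ (A ^ (j + 1) * ‖z‖ ^ (j + 2)) * M ^ (j + 2) := by
            rw [norm_mul, norm_pow]
            gcongr
            · exact hF j
            · exact (tsum_coeff_pow hs (j + 2)).2.2.trans
                (pow_le_pow_left₀ (tsum_nonneg fun _ => norm_nonneg _) hM _)
        _ = _ := by ring
  have hs1 : Summable fun n => PowerSeries.coeff n w * z ^ n := hs.of_norm
  have hs2 : Summable fun n => PowerSeries.coeff n w * (lam * z) ^ n := by
    refine Summable.of_norm (hs.congr fun n => ?_)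
    simp [hlam]
  have hL : lam * z * (∑' n, PowerSeries.coeff n w * (lam * z) ^ n - W) =
      ∑' a, ∑ p ∈ Finset.HasAntidiagonal.antidiagonal a,
        F p.1 * z ^ (p.1 + 2) * (PowerSeries.coeff p.2 (w ^ (p.1 + 2)) * z ^ p.2) := by
    rw [hW, ← hs2.tsum_sub hs1, (hs2.sub hs1).tsum_eq_zero_add]
    simp only [pow_zero, sub_self, zero_add]
    rw [← tsum_mul_left]
    refine tsum_congr fun a => ?_
    have e : ∀ p ∈ Finset.HasAntidiagonal.antidiagonal a,
        F p.1 * z ^ (p.1 + 2) * (PowerSeries.coeff p.2 (w ^ (p.1 + 2)) * z ^ p.2) =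
        z ^ (a + 2) * (F p.1 * PowerSeries.coeff p.2 (w ^ (p.1 + 2))) := by
      intro p hp
      rw [← Finset.HasAntidiagonal.mem_antidiagonal.1 hp]; ring
    rw [Finset.sum_congr rfl e, ← Finset.mul_sum, ← hw]
    ring
  rw [hR, ← hL]; ring

theorem exists_expansion {U : Set ℂ} (hU : IsOpen U) {z₀ : ℂ} (hz₀ : z₀ ∈ U) {f : ℂ → ℂ}
    (hf : DifferentiableOn ℂ f U) (hfix : f z₀ = z₀) :
    ∃ (F : ℕ → ℂ) (A R : ℝ), 1 ≤ A ∧ 0 < R ∧ Metric.ball z₀ R ⊆ U ∧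
      (∀ j, ‖F j‖ ≤ A ^ (j + 1)) ∧ ∀ y : ℂ, ‖y‖ < R →
        f (z₀ + y) = z₀ + deriv f z₀ * y + ∑' j, F j * y ^ (j + 2) := by
  obtain ⟨R, hR, hRU⟩ := Metric.isOpen_iff.1 hU z₀ hz₀
  obtain ⟨p, r, hp⟩ := hf.analyticAt (hU.mem_nhds hz₀)
  obtain ⟨C, s, hC, hs, hbound⟩ := p.le_mul_pow_of_radius_pos hp.radius_pos
  obtain ⟨R', hR', hR'r⟩ := ENNReal.lt_iff_exists_nnreal_btwn.1 hp.r_pos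
  have hR'0 : (0 : ℝ) < R' := by exact_mod_cast hR'
  refine ⟨fun j => p.coeff (j + 2), (1 + C) * (1 + s) ^ 2, min R R', ?_, lt_min hR hR'0,
    (Metric.ball_subset_ball (min_le_left _ _)).trans hRU, fun j => ?_, fun y hy => ?_⟩
  · nlinarith [one_le_pow₀ (n := 2) (by linarith : 1 ≤ 1 + s)]
  · rw [← p.norm_apply_eq_norm_coef]
    calc _ ≤ C * s ^ (j + 2) := hbound _
      _ ≤ (1 + C) ^ (j + 1) * (1 + s) ^ (2 * (j + 1)) := by
          gcongr ?_ * ?_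
          · calc C ≤ (1 + C) ^ 1 := by linarith
              _ ≤ _ := pow_le_pow_right₀ (by linarith) (by omega)
          · calc s ^ (j + 2) ≤ (1 + s) ^ (j + 2) := by gcongr; linarith
              _ ≤ _ := pow_le_pow_right₀ (by linarith) (by omega)
      _ = _ := by rw [mul_pow, pow_mul]
  · have hy' : y ∈ Metric.eball (0 : ℂ) r := by
      rw [Metric.mem_eball, edist_zero_right]
      refine lt_trans ?_ hR'r
      rw [← ofReal_norm, ENNReal.ofReal_lt_coe_iff (norm_nonneg _)]
      exact hy.trans_le (min_le_right _ _)
    have h := hp.hasSum hy'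
    have h1 : deriv f z₀ = p.coeff 1 := hp.hasFPowerSeriesAt.deriv
    have h0 : p.coeff 0 = z₀ := by
      rw [← hfix]; exact hp.hasFPowerSeriesAt.coeff_zero _
    rw [← h.tsum_eq, ← h.summable.sum_add_tsum_nat_add 2, h1]
    simp only [FormalMultilinearSeries.apply_eq_pow_smul_coeff, Finset.sum_range_succ,
      Finset.sum_range_zero, smul_eq_mul, h0]
    rw [tsum_congr fun j => mul_comm (y ^ (j + 2)) (p.coeff (j + 2))]
    ring

/-- Brjuno's theorem: if `θ` is an irrational Brjuno number and `f` is holomorphic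
near a fixed point `z₀` with multiplier `e^{2πiθ}`, then `f` is linearizable
at `z₀`. -/
theorem brjuno_linearizable (θ : ℝ) (hθ : θ ∈ Set.Ioo (0 : ℝ) 1)
    (hirr : Irrational θ) (hB : IsBrjuno θ)
    (U : Set ℂ) (hU : IsOpen U) (z₀ : ℂ) (hz₀ : z₀ ∈ U)
    (f : ℂ → ℂ) (hf : DifferentiableOn ℂ f U)
    (hfix : f z₀ = z₀)
    (hmult : deriv f z₀ = Complex.exp (2 * Real.pi * Complex.I * θ)) :
    ∃ ρ : ℝ, 0 < ρ ∧ ∃ φ : ℂ → ℂ,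
      Set.InjOn φ (Metric.ball (0 : ℂ) ρ) ∧
      DifferentiableOn ℂ φ (Metric.ball (0 : ℂ) ρ) ∧
      Set.MapsTo φ (Metric.ball (0 : ℂ) ρ) U ∧
      φ 0 = z₀ ∧
      ∀ z ∈ Metric.ball (0 : ℂ) ρ,
        f (φ z) = φ (Complex.exp (2 * Real.pi * Complex.I * θ) * z) := by
  set lam := Complex.exp (2 * Real.pi * Complex.I * θ) with hlam
  have hlam1 : ‖lam‖ = 1 := by
    rw [hlam, show (2 * Real.pi * Complex.I * θ : ℂ) = ((2 * Real.pi * θ : ℝ) : ℂ) * Complex.I by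
      push_cast; ring]
    exact Complex.norm_exp_ofReal_mul_I _
  have hlam0 : lam ≠ 0 := Complex.exp_ne_zero _
  obtain ⟨K, C, hK0, hKC, hKadd, hKdiv⟩ := exists_superadditive_small_divisor hθ hirr hB
  obtain ⟨F, A, R, hA, hR, hRU, hF, hexp⟩ := exists_expansion hU hz₀ hf hfix
  have hA0 : 0 < A := by linarith
  have hdiv0 : ∀ a, lam * (lam ^ (a + 1) - 1) ≠ 0 := fun a =>
    mul_ne_zero hlam0 (norm_pos_iff.1 ((Real.exp_pos _).trans_le (hKdiv a)))
  obtain ⟨w, hw0, hw⟩ := exists_formal_linearization (fun a => (lam * (lam ^ (a + 1) - 1))⁻¹) F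
  have hw' : ∀ a, lam * (lam ^ (a + 1) - 1) * PowerSeries.coeff (a + 1) w =
      ∑ p ∈ Finset.HasAntidiagonal.antidiagonal a,
        F p.1 * PowerSeries.coeff p.2 (w ^ (p.1 + 2)) := fun a => by
    rw [hw, mul_inv_cancel_left₀ (hdiv0 a)]
  set r := 1 / (8 * A) with hr
  have hr0 : 0 < r := by positivity
  have hmaj := norm_linearization_mul_le (κ := fun a => Real.exp (-K a) * r ^ a) hA0 hr0
    (by rw [hr]; apply le_of_eq; field_simp) hF (fun a => by positivity)
    (fun a b => by
      calc _ ≤ Real.exp (-K a + -K b) * r ^ (a + b) := by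
            gcongr; linarith [hKadd a b]
        _ = _ := by rw [Real.exp_add, pow_add]; ring)
    (fun a => mul_le_of_le_one_left (by positivity) (Real.exp_le_one_iff.2 (by linarith [hK0 a])))
    (fun a => by
      rw [norm_inv, norm_mul, hlam1, one_mul]
      have h1 : ‖lam ^ (a + 1) - 1‖⁻¹ ≤ Real.exp (K (a + 1) - K a) := by
        rw [← neg_sub (K a), Real.exp_neg]
        exact inv_anti₀ (Real.exp_pos _) (hKdiv a)
      calc _ ≤ Real.exp (K (a + 1) - K a) * (Real.exp (-K (a + 1)) * r ^ (a + 1)) := by gcongr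
        _ = Real.exp (K (a + 1) - K a + -K (a + 1)) * r ^ (a + 1) := by
            rw [Real.exp_add]; ring
        _ = _ := by
            rw [show K (a + 1) - K a + -K (a + 1) = -K a by ring, pow_succ]; ring) hw0 hw
  set Q := Real.exp C / r with hQ
  have hQ0 : 0 < Q := by positivity
  have hwQ : ∀ a, ‖PowerSeries.coeff a w‖ ≤ 2 * Q ^ a := by
    intro a
    have h2 : 0 < Real.exp (-K a) * r ^ a := by positivity
    calc _ ≤ 2 / (Real.exp (-K a) * r ^ a) := (le_div_iff₀ h2).2 (hmaj a)
      _ = 2 * (Real.exp (K a) / r ^ a) := by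
          have := pow_pos hr0 a
          rw [Real.exp_neg]; generalize r ^ a = s at *; field_simp
      _ ≤ 2 * (Real.exp (a * C) / r ^ a) := by
          gcongr; linarith [hKC a]
      _ = _ := by rw [hQ, div_pow (Real.exp C) r, Real.exp_nat_mul]
  set W : ℂ → ℂ := fun z => ∑' n, PowerSeries.coeff n w * z ^ n with hW
  set ρ₁ := 1 / (2 * Q) with hρ₁
  have hρ₁0 : 0 < ρ₁ := by positivity
  have hterm : ∀ (n : ℕ) (z : ℂ), z ∈ Metric.ball (0 : ℂ) ρ₁ →
      ‖PowerSeries.coeff n w * z ^ n‖ ≤ 2 * (1 / 2 : ℝ) ^ n := by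
    intro n z hz
    rw [mem_ball_zero_iff] at hz
    rw [norm_mul, norm_pow]
    calc _ ≤ (2 * Q ^ n) * ρ₁ ^ n := by gcongr; exact hwQ n
      _ = 2 * (Q * ρ₁) ^ n := by rw [mul_pow]; ring
      _ = _ := by
          congr 2; rw [hρ₁]; field_simp
  have hgeo : HasSum (fun n : ℕ => 2 * (1 / 2 : ℝ) ^ n) 4 := by
    have := hasSum_geometric_two.mul_left 2
    norm_num at this ⊢; exact this
  have hWs : ∀ z ∈ Metric.ball (0 : ℂ) ρ₁, Summable fun n => ‖PowerSeries.coeff n w * z ^ n‖ :=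
    fun z hz => Summable.of_nonneg_of_le (fun _ => norm_nonneg _) (fun n => hterm n z hz)
      hgeo.summable
  have hW4 : ∀ z ∈ Metric.ball (0 : ℂ) ρ₁, ∑' n, ‖PowerSeries.coeff n w * z ^ n‖ ≤ 4 :=
    fun z hz => ((hWs z hz).tsum_le_tsum (fun n => hterm n z hz) hgeo.summable).trans_eq
      hgeo.tsum_eq
  have hWd : DifferentiableOn ℂ W (Metric.ball 0 ρ₁) :=
    differentiableOn_tsum_of_summable_norm hgeo.summable
      (fun n => by fun_prop) Metric.isOpen_ball hterm
  set φ : ℂ → ℂ := fun z => z₀ + z * W z with hφ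
  have hφd : DifferentiableOn ℂ φ (Metric.ball 0 ρ₁) :=
    (differentiableOn_id.mul hWd).const_add z₀
  have hφ' : HasStrictDerivAt φ 1 0 := by
    have hnhds := Metric.ball_mem_nhds (0 : ℂ) hρ₁0
    have h1 := (hφd.analyticAt hnhds).hasStrictDerivAt
    have h2 : HasDerivAt φ (1 * W 0 + 0 * deriv W 0) 0 :=
      ((hasDerivAt_id (0 : ℂ)).mul (hWd.differentiableAt hnhds).hasDerivAt).const_add z₀
    have hW0 : W 0 = 1 := by
      simp only [hW]
      rw [tsum_eq_single 0 fun n hn => by simp [hn], hw0]; simp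
    rw [hW0, one_mul, zero_mul, add_zero] at h2
    rwa [h2.deriv] at h1
  obtain ⟨ρ₂, hρ₂0, hinv⟩ := Metric.eventually_nhds_iff_ball.1
    (hφ'.hasStrictFDerivAt_equiv one_ne_zero).eventually_left_inverse
  set ρ := min (min ρ₁ ρ₂) (min (R / 4) (1 / (4 * A))) with hρ
  have hρ0 : 0 < ρ := lt_min (lt_min hρ₁0 hρ₂0) (lt_min (by positivity) (by positivity))
  have hsub₁ : Metric.ball (0 : ℂ) ρ ⊆ Metric.ball 0 ρ₁ :=
    Metric.ball_subset_ball ((min_le_left _ _).trans (min_le_left _ _))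
  have hsub₂ : Metric.ball (0 : ℂ) ρ ⊆ Metric.ball 0 ρ₂ :=
    Metric.ball_subset_ball ((min_le_left _ _).trans (min_le_right _ _))
  have hsmall : ∀ z ∈ Metric.ball (0 : ℂ) ρ, ‖z * W z‖ < R := by
    intro z hz
    have h1 : ‖W z‖ ≤ 4 := (norm_tsum_le_tsum_norm (hWs z (hsub₁ hz))).trans (hW4 z (hsub₁ hz))
    rw [mem_ball_zero_iff] at hz
    have h2 : ‖z‖ < R / 4 := hz.trans_le ((min_le_right _ _).trans (min_le_left _ _))
    rw [norm_mul]
    nlinarith [norm_nonneg z]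
  refine ⟨ρ, hρ0, φ, ?_, hφd.mono hsub₁, ?_, by simp [hφ], ?_⟩
  · intro x hx y hy hxy
    rw [← hinv x (hsub₂ hx), ← hinv y (hsub₂ hy), hxy]
  · intro z hz
    apply hRU
    rw [Metric.mem_ball, dist_eq_norm]
    simpa [hφ] using hsmall z hz
  · intro z hz
    have h2 : ‖z‖ < 1 / (4 * A) := by
      rw [mem_ball_zero_iff] at hz
      exact hz.trans_le ((min_le_right _ _).trans (min_le_right _ _))
    rw [lt_div_iff₀ (by positivity)] at h2
    have key := tsum_linearization hlam1 hA0 hF hw' (hWs z (hsub₁ hz)) (hW4 z (hsub₁ hz))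
      (by linarith)
    change f (z₀ + z * W z) = z₀ + lam * z * W (lam * z)
    rw [hexp _ (hsmall z hz), hmult]
    simp only [hW]
    rw [key]
    ring
end

section
/- Let W ⊊ ℂ be a bounded, open, connected, simply connected set and let γ be a crosscut of W. Then W∖γ has exactly two connected components, and both are open. -/
open Complex

/-- `γ` is a crosscut of `W`: the image of `(0,1)` under a continuous injective
map `g : [0,1] → ℂ` whose open part lies in `W` and whose endpoints are on the
boundary of `W`. -/
def IsCrosscut (W γ : Set ℂ) : Prop :=
  ∃ g : ℝ → ℂ, ContinuousOn g (Set.Icc 0 1) ∧ Set.InjOn g (Set.Icc 0 1) ∧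
    γ = g '' Set.Ioo 0 1 ∧ g '' Set.Ioo 0 1 ⊆ W ∧
    g 0 ∈ frontier W ∧ g 1 ∈ frontier W

/-- Two continuous logarithms of the same function on a preconnected set differ by a constant. -/
theorem IsPreconnected.exists_log_eq_add_const {X : Type*} [TopologicalSpace X] {S : Set X}
    (hS : IsPreconnected S) {k l : X → ℂ} (hk : ContinuousOn k S) (hl : ContinuousOn l S)
    (h : ∀ z ∈ S, exp (k z) = exp (l z)) :
    ∃ c : ℂ, exp c = 1 ∧ ∀ z ∈ S, k z = l z + c := by
  rcases S.eq_empty_or_nonempty with rfl | ⟨a, ha⟩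
  · exact ⟨0, by simp⟩
  have hc : exp (k a - l a) = 1 := by rw [exp_sub, h a ha, div_self (exp_ne_zero _)]
  refine ⟨k a - l a, hc, ?_⟩
  exact isCoveringMap_exp.isSeparatedMap.eqOn_of_comp_eqOn
    isCoveringMap_exp.isLocalHomeomorph.isLocallyInjective hS hk
    (hl.add continuousOn_const : ContinuousOn (fun z => l z + (k a - l a)) S)
    (fun z hz => by simp [exp_add, hc, h z hz]) ha (by simp)

/-- A nonzero power of `z - p` has no continuous logarithm on a circle centred at `p`. -/
theorem not_exists_log_zpow_on_sphere {p : ℂ} {r : ℝ} (hr : 0 < r) {n : ℤ} (hn : n ≠ 0) {l : ℂ → ℂ}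
    (hl : ContinuousOn l (Metric.sphere p r))
    (h : ∀ z ∈ Metric.sphere p r, exp (l z) = (z - p) ^ n) : False := by
  have hr' : (r : ℂ) ≠ 0 := by exact_mod_cast hr.ne'
  obtain ⟨c, -, hc⟩ := isPreconnected_univ.exists_log_eq_add_const
    (k := fun t : ℝ => l (circleMap p r t)) (l := fun t : ℝ => n * (Complex.log r + t * I))
    (hl.comp (continuous_circleMap p r).continuousOn
      fun t _ => circleMap_mem_sphere p hr.le t)
    (by fun_prop) (fun t _ => by
      rw [h _ (circleMap_mem_sphere p hr.le t), exp_int_mul, exp_add, exp_log hr']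
      simp [circleMap])
  have h0 := hc 0 trivial
  have h1 := hc (2 * Real.pi) trivial
  have hper : circleMap p r (2 * Real.pi) = circleMap p r 0 := by
    simpa using periodic_circleMap p r 0
  simp only [hper, h0] at h1
  have : (n : ℂ) * (2 * Real.pi * I) = 0 := by push_cast at h1; linear_combination -h1
  simp [hn, Real.pi_ne_zero] at this

/-- As the pole moves along a path avoiding `S`, the quotient `(z - c 1) / (z - c 0)` acquires a
continuous logarithm on `S`. -/
theorem exists_log_div_sub_of_path {S : Set ℂ} (c : C(unitInterval, ℂ)) (hc : ∀ t, c t ∉ S) :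
    ∃ l : ℂ → ℂ, ContinuousOn l S ∧ ∀ z ∈ S, exp (l z) = (z - c 1) / (z - c 0) := by
  classical
  have hne (t : unitInterval) (z : S) : (z : ℂ) - c t ≠ 0 :=
    sub_ne_zero.2 fun h => hc t (h ▸ z.2)
  let H : C(unitInterval × S, {z : ℂ // z ≠ 0}) :=
    ⟨fun q => ⟨((q.2 : ℂ) - c q.1) / (q.2 - c 0), div_ne_zero (hne _ _) (hne _ _)⟩, by
      refine Continuous.subtype_mk (Continuous.div (by fun_prop) (by fun_prop) ?_) _
      exact fun q => hne _ _⟩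
  have H0 : ∀ a, H (0, a) = (⟨_, exp_ne_zero ((ContinuousMap.const S (0 : ℂ)) a)⟩ :
      {z : ℂ // z ≠ 0}) := fun a => Subtype.ext (by simp [H, div_self (hne 0 a)])
  let L := isCoveringMap_exp.liftHomotopy H (ContinuousMap.const S 0) H0
  have hL := isCoveringMap_exp.liftHomotopy_lifts H (ContinuousMap.const S 0) H0
  refine ⟨fun z => if h : z ∈ S then L (1, ⟨z, h⟩) else 0, ?_, fun z hz => ?_⟩
  · rw [continuousOn_iff_continuous_domRestrict]
    have : Continuous fun z : S => L (1, z) := by fun_prop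
    convert! this with z
    simp
  · simpa only [dif_pos hz] using! congrArg Subtype.val (congrFun hL (1, ⟨z, hz⟩))

/-- Continuous logarithms on two sets, both closed or both open, that agree on the intersection
can be glued. -/
theorem exists_log_union {C A : Set ℂ} (hCA : IsClosed C ∧ IsClosed A ∨ IsOpen C ∧ IsOpen A)
    {f k l : ℂ → ℂ} (hk : ContinuousOn k C) (hl : ContinuousOn l A)
    (hkl : ∀ z ∈ C, z ∈ A → k z = l z)
    (hkf : ∀ z ∈ C, exp (k z) = f z) (hlf : ∀ z ∈ A, exp (l z) = f z) :
    ∃ m : ℂ → ℂ, ContinuousOn m (C ∪ A) ∧ ∀ z ∈ C ∪ A, exp (m z) = f z := by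
  classical
  have h1 : Set.EqOn (C.piecewise k l) k C := fun z hz => by simp [hz]
  have h2 : Set.EqOn (C.piecewise k l) l A := fun z hz => by
    by_cases h : z ∈ C
    · simp [h, hkl z h hz]
    · simp [h]
  refine ⟨C.piecewise k l, ?_, ?_⟩
  · rcases hCA with ⟨hC, hA⟩ | ⟨hC, hA⟩
    · exact (hk.congr h1).union_of_isClosed (hl.congr h2) hC hA
    · exact (hk.congr h1).union_of_isOpen (hl.congr h2) hC hA
  · rintro z (hz | hz)
    · rw [h1 hz, hkf z hz]
    · rw [h2 hz, hlf z hz]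

/-- A nowhere vanishing continuous function on an arc has a continuous logarithm. -/
theorem exists_log_on_arc {g : ℝ → ℂ} (hg : ContinuousOn g (Set.Icc 0 1))
    (hgi : Set.InjOn g (Set.Icc 0 1)) {f : ℂ → ℂ} (hf : ContinuousOn f (g '' Set.Icc 0 1))
    (hf0 : ∀ z ∈ g '' Set.Icc 0 1, f z ≠ 0) :
    ∃ l : ℂ → ℂ, Continuous l ∧ ∀ z ∈ g '' Set.Icc 0 1, exp (l z) = f z := by
  let e : Set.Icc (0 : ℝ) 1 → ℂ := (Set.Icc 0 1).domRestrict g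
  have he : Topology.IsClosedEmbedding e :=
    Continuous.isClosedEmbedding (continuousOn_iff_continuous_domRestrict.1 hg)
      (Set.injOn_iff_injective.1 hgi)
  have hem (t) : e t ∈ g '' Set.Icc 0 1 := ⟨t, t.2, rfl⟩
  let F : C(ℝ, ℂ) := ⟨fun t => f (e (Set.projIcc 0 1 zero_le_one t)),
    hf.comp_continuous (he.continuous.comp continuous_projIcc) fun t => hem _⟩
  obtain ⟨L, ⟨-, hL⟩, -⟩ := isCoveringMapOn_exp.existsUnique_continuousMap_lifts F (a₀ := 0)
    (e₀ := Complex.log (F 0)) (exp_log (hf0 _ (hem _))) (fun t => hf0 _ (hem _))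
  obtain ⟨l, hl⟩ := ContinuousMap.exists_extension' he (L.comp ⟨Subtype.val, by fun_prop⟩)
  refine ⟨l, l.continuous, ?_⟩
  rintro _ ⟨t, ht, rfl⟩
  have h1 : l (g t) = L t := congrFun hl ⟨t, ht⟩
  have h2 : exp (L t) = F t := congrFun hL t
  rw [h1, h2]
  simp [F, e, Set.projIcc_of_mem zero_le_one ht]

/-- If `D` is a bounded open set containing `x`, then a nonzero power of `z - x` is not, on the
frontier of `D`, the product of an exponential and a function that extends to a nowhere vanishing
continuous function on the closure of `D`. -/
theorem not_exists_log_zpow_div_on_frontier {D : Set ℂ} (hDo : IsOpen D)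
    (hDb : Bornology.IsBounded D) {x : ℂ} (hx : x ∈ D) {n : ℤ} (hn : n ≠ 0) {G l : ℂ → ℂ}
    (hG : ContinuousOn G (closure D)) (hG0 : ∀ z ∈ closure D, G z ≠ 0)
    (hl : ContinuousOn l (frontier D))
    (h : ∀ z ∈ frontier D, exp (l z) * G z = (z - x) ^ n) : False := by
  classical
  obtain ⟨θ, hθ⟩ := ContinuousMap.exists_restrict_eq isClosed_frontier
    ⟨_, continuousOn_iff_continuous_domRestrict.1 hl⟩
  have hθ' (z) (hz : z ∈ frontier D) : θ z = l z := by
    simpa using DFunLike.congr_fun hθ ⟨z, hz⟩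
  have hne (z) (hz : z ∈ Dᶜ) : z - x ≠ 0 := sub_ne_zero.2 fun h => hz (h ▸ hx)
  let F := D.piecewise (fun z => exp (θ z) * G z) (fun z => (z - x) ^ n)
  have hF : Continuous F := by
    refine continuous_piecewise (fun z hz => by rw [hθ' z hz, h z hz])
      (ContinuousOn.mul (by fun_prop) hG) ?_
    rw [hDo.isClosed_compl.closure_eq]
    exact ContinuousOn.zpow₀ (by fun_prop) n fun z hz => Or.inl (hne z hz)
  have hF0 (z) : F z ≠ 0 := by
    by_cases hz : z ∈ D
    · simp [F, hz, hG0 z (subset_closure hz)]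
    · simpa [F, hz] using zpow_ne_zero n (hne z hz)
  obtain ⟨L, ⟨-, hL⟩, -⟩ := isCoveringMapOn_exp.existsUnique_continuousMap_lifts ⟨F, hF⟩
    (a₀ := 0) (exp_log (hF0 0)) (fun z => hF0 z)
  obtain ⟨R, hR0, hR⟩ := hDb.subset_ball_lt 0 x
  refine not_exists_log_zpow_on_sphere (p := x) hR0 hn (l := L) L.continuous.continuousOn fun z hz => ?_
  have hzD : z ∉ D := fun hzD => by
    have := hR hzD
    rw [Metric.mem_ball, Metric.mem_sphere.1 hz] at this
    exact lt_irrefl _ this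
  have : exp (L z) = F z := congrFun hL z
  simp [this, F, hzD]

/-- Points in the closure of a connected component of an open set `F` that lie in `F` belong to
that component. -/
theorem IsOpen.mem_connectedComponentIn_of_mem_closure {X : Type*} [TopologicalSpace X]
    [LocallyConnectedSpace X] {F : Set X} (hF : IsOpen F) {x y : X} (hy : y ∈ F)
    (h : y ∈ closure (connectedComponentIn F x)) : y ∈ connectedComponentIn F x := by
  obtain ⟨z, hz, hz'⟩ := mem_closure_iff.1 h _ hF.connectedComponentIn (mem_connectedComponentIn hy)
  rw [connectedComponentIn_eq hz', ← connectedComponentIn_eq hz]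
  exact mem_connectedComponentIn hy

theorem IsOpen.frontier_connectedComponentIn_subset {X : Type*} [TopologicalSpace X]
    [LocallyConnectedSpace X] {F : Set X} (hF : IsOpen F) (x : X) :
    frontier (connectedComponentIn F x) ⊆ Fᶜ := fun _ hy hyF =>
  hF.connectedComponentIn.frontier_eq ▸ hy |>.2
    (hF.mem_connectedComponentIn_of_mem_closure hyF (frontier_subset_closure hy))

/-- Logarithms of `(z - x) / (z - y)` on the complement of a domain and on an arc, normalized to
agree at the initial point of the arc; at the terminal point they differ by a period. -/
theorem exists_log_div_sub_on_compl_and_arc {W : Set ℂ} (hW : IsPathConnected W) {g : ℝ → ℂ}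
    (hg : ContinuousOn g (Set.Icc 0 1)) (hgi : Set.InjOn g (Set.Icc 0 1))
    (h0 : g 0 ∉ W) (h1 : g 1 ∉ W) {x y : ℂ} (hx : x ∈ W) (hy : y ∈ W)
    (hxg : x ∉ g '' Set.Icc 0 1) (hyg : y ∉ g '' Set.Icc 0 1) :
    ∃ (k l : ℂ → ℂ) (a : ℤ), ContinuousOn k Wᶜ ∧ ContinuousOn l (g '' Set.Icc 0 1) ∧
      (∀ z ∈ Wᶜ, exp (k z) = (z - x) / (z - y)) ∧
      (∀ z ∈ g '' Set.Icc 0 1, exp (l z) = (z - x) / (z - y)) ∧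
      k (g 0) = l (g 0) ∧ k (g 1) = l (g 1) + a * (2 * Real.pi * I) := by
  have hne {w z : ℂ} {S : Set ℂ} (hw : w ∉ S) (hz : z ∈ S) : z - w ≠ 0 :=
    sub_ne_zero.2 fun h => hw (h ▸ hz)
  obtain ⟨c, hc⟩ := hW.joinedIn y hy x hx
  obtain ⟨k, hk, hkf⟩ := exists_log_div_sub_of_path (S := Wᶜ) c.toContinuousMap
    fun t ht => ht (hc t)
  have hkf' : ∀ z ∈ Wᶜ, exp (k z) = (z - x) / (z - y) := by simpa using hkf
  obtain ⟨l, hl, hlf⟩ := exists_log_on_arc hg hgi (f := fun z => (z - x) / (z - y))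
    (ContinuousOn.div (by fun_prop) (by fun_prop) fun z => hne hyg)
    (fun z hz => div_ne_zero (hne hxg hz) (hne hyg hz))
  have m0 : g 0 ∈ g '' Set.Icc 0 1 := ⟨0, by simp, rfl⟩
  have m1 : g 1 ∈ g '' Set.Icc 0 1 := ⟨1, by simp, rfl⟩
  have hlf' : ∀ z ∈ g '' Set.Icc 0 1, exp (l z + (k (g 0) - l (g 0))) = (z - x) / (z - y) :=
    fun z hz => by
      rw [exp_add, exp_sub, hlf z hz, hkf' _ h0, hlf _ m0, div_self, mul_one]
      exact div_ne_zero (hne hxg m0) (hne hyg m0)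
  obtain ⟨a, ha⟩ := exp_eq_exp_iff_exists_int.1 ((hkf' _ h1).trans (hlf' _ m1).symm)
  exact ⟨k, fun z => l z + (k (g 0) - l (g 0)), a, hk, by fun_prop, hkf', hlf', by ring, ha⟩

theorem isClosed_arc {g : ℝ → ℂ} {a b : ℝ} (hg : ContinuousOn g (Set.Icc a b)) :
    IsClosed (g '' Set.Icc a b) :=
  (isCompact_Icc.image_of_continuousOn hg).isClosed

/-- Removing the relative interior of an arc whose endpoints lie outside `W` amounts, within `W`,
to removing the whole arc. -/
theorem diff_image_Ioo_eq_compl {W : Set ℂ} {g : ℝ → ℂ} (h0 : g 0 ∉ W) (h1 : g 1 ∉ W) :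
    W \ g '' Set.Ioo 0 1 = (Wᶜ ∪ g '' Set.Icc 0 1)ᶜ := by
  ext z
  simp only [Set.mem_sdiff, Set.mem_compl_iff, Set.mem_union, not_or, not_not]
  refine and_congr_right fun hz => not_congr ⟨fun h => Set.image_mono Set.Ioo_subset_Icc_self h, ?_⟩
  rintro ⟨t, ht, rfl⟩
  exact ⟨t, ⟨ht.1.lt_of_ne fun h => h0 (h ▸ hz), ht.2.lt_of_ne fun h => h1 (h ▸ hz)⟩, rfl⟩

/-- An arc in a bounded domain joining two points outside the domain leaves at most two
components. -/
theorem not_three_components_diff_arc {W : Set ℂ} (hWb : Bornology.IsBounded W) (hWo : IsOpen W)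
    (hWc : IsConnected W) {g : ℝ → ℂ}
    (hg : ContinuousOn g (Set.Icc 0 1)) (hgi : Set.InjOn g (Set.Icc 0 1))
    (hgW : g '' Set.Ioo 0 1 ⊆ W) (h0 : g 0 ∉ W) (h1 : g 1 ∉ W) {x y w : ℂ}
    (hx : x ∈ W \ g '' Set.Ioo 0 1) (hy : y ∈ W \ g '' Set.Ioo 0 1)
    (hw : w ∈ W \ g '' Set.Ioo 0 1)
    (hyx : y ∉ connectedComponentIn (W \ g '' Set.Ioo 0 1) x)
    (hxw : x ∉ connectedComponentIn (W \ g '' Set.Ioo 0 1) w)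
    (hyw : y ∉ connectedComponentIn (W \ g '' Set.Ioo 0 1) w) : False := by
  have hWp : IsPathConnected W := hWo.isConnected_iff_isPathConnected.1 hWc
  have hF := diff_image_Ioo_eq_compl h0 h1
  have hcl : IsClosed Wᶜ ∧ IsClosed (g '' Set.Icc 0 1) := ⟨hWo.isClosed_compl, isClosed_arc hg⟩
  have hFo : IsOpen (W \ g '' Set.Ioo 0 1) := hF ▸ (hcl.1.union hcl.2).isOpen_compl
  have hb (u) : Bornology.IsBounded (connectedComponentIn (W \ g '' Set.Ioo 0 1) u) :=
    hWb.subset ((connectedComponentIn_subset _ _).trans Set.sdiff_subset)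
  have hfr (u) : frontier (connectedComponentIn (W \ g '' Set.Ioo 0 1) u) ⊆
      Wᶜ ∪ g '' Set.Icc 0 1 := by
    simpa only [hF, compl_compl] using hFo.frontier_connectedComponentIn_subset u
  have harc {u} (hu : u ∈ W \ g '' Set.Ioo 0 1) : u ∉ g '' Set.Icc 0 1 := fun h => by
    rw [hF] at hu; exact hu (Or.inr h)
  have hne {u z : ℂ} {S : Set ℂ} (hu : u ∉ S) (hz : z ∈ S) : z - u ≠ 0 :=
    sub_ne_zero.2 fun h => hu (h ▸ hz)
  have hK {u} (hu : u ∈ W \ g '' Set.Ioo 0 1) : u ∉ Wᶜ ∪ g '' Set.Icc 0 1 := by rwa [hF] at hu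
  have hcap {z} (hz : z ∈ Wᶜ) (hz' : z ∈ g '' Set.Icc 0 1) : z = g 0 ∨ z = g 1 := by
    obtain ⟨t, ht, rfl⟩ := hz'
    by_contra! h
    exact hz (hgW ⟨t, ⟨ht.1.lt_of_ne fun e => h.1 (e ▸ rfl), ht.2.lt_of_ne fun e => h.2 (e ▸ rfl)⟩,
      rfl⟩)
  obtain ⟨k, l, a, hk, hl, hkf, hlf, e0, e1⟩ := exists_log_div_sub_on_compl_and_arc hWp hg hgi h0 h1
    hx.1 hy.1 (harc hx) (harc hy)
  obtain ⟨k', l', b, hk', hl', hkf', hlf', e0', e1'⟩ :=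
    exists_log_div_sub_on_compl_and_arc hWp hg hgi h0 h1 hy.1 hw.1 (harc hy) (harc hw)
  by_cases ha : a = 0
  · obtain ⟨m, hm, hmf⟩ := exists_log_union (Or.inl hcl) hk hl (fun z hz hz' => by
      rcases hcap hz hz' with rfl | rfl
      · exact e0
      · simpa [ha] using e1) hkf hlf
    refine not_exists_log_zpow_div_on_frontier hFo.connectedComponentIn (hb x)
      (mem_connectedComponentIn hx) one_ne_zero (G := fun z => z - y) (by fun_prop)
      (fun z => hne fun h => hyx (hFo.mem_connectedComponentIn_of_mem_closure hy h))
      (hm.mono (hfr x)) fun z hz => ?_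
    rw [hmf z (hfr x hz), zpow_one, div_mul_cancel₀ _ (hne (hK hy) (hfr x hz))]
  · obtain ⟨m, hm, hmf⟩ := exists_log_union (Or.inl hcl)
      (f := fun z => ((z - x) / (z - y)) ^ b * ((z - y) / (z - w)) ^ (-a))
      (k := fun z => b * k z + (-a : ℤ) * k' z) (l := fun z => b * l z + (-a : ℤ) * l' z)
      (by fun_prop) (by fun_prop) (fun z hz hz' => by
        rcases hcap hz hz' with rfl | rfl
        · rw [e0, e0']
        · rw [e1, e1']; push_cast; ring)
      (fun z hz => by rw [exp_add, exp_int_mul, exp_int_mul, hkf z hz, hkf' z hz])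
      (fun z hz => by rw [exp_add, exp_int_mul, exp_int_mul, hlf z hz, hlf' z hz])
    have hxc : x ∉ closure (connectedComponentIn (W \ g '' Set.Ioo 0 1) w) :=
      fun h => hxw (hFo.mem_connectedComponentIn_of_mem_closure hx h)
    have hyc : y ∉ closure (connectedComponentIn (W \ g '' Set.Ioo 0 1) w) :=
      fun h => hyw (hFo.mem_connectedComponentIn_of_mem_closure hy h)
    refine not_exists_log_zpow_div_on_frontier hFo.connectedComponentIn (hb w)
      (mem_connectedComponentIn hw) ha
      (G := fun z => ((z - x) / (z - y)) ^ (-b) * (z - y) ^ a)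
      (ContinuousOn.mul (ContinuousOn.zpow₀ (ContinuousOn.div (by fun_prop) (by fun_prop) ?_) _ ?_)
        (ContinuousOn.zpow₀ (by fun_prop) _ ?_)) ?_ (hm.mono (hfr w)) fun z hz => ?_
    · exact fun z => hne hyc
    · exact fun z hz => Or.inl (div_ne_zero (hne hxc hz) (hne hyc hz))
    · exact fun z hz => Or.inl (hne hyc hz)
    · exact fun z hz => mul_ne_zero (zpow_ne_zero _ (div_ne_zero (hne hxc hz) (hne hyc hz)))
        (zpow_ne_zero _ (hne hyc hz))
    · have hx' := hne (hK hx) (hfr w hz)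
      have hy' := hne (hK hy) (hfr w hz)
      have hw' := hne (hK hw) (hfr w hz)
      rw [hmf z (hfr w hz)]
      simp only [div_zpow, zpow_neg]
      field_simp

/-- On a subset of a simply connected domain avoided by a path entering from outside the domain,
`z - c 1` has a continuous logarithm. -/
theorem exists_log_sub_of_path {W S : Set ℂ} (hWo : IsOpen W) (hW : IsSimplyConnected W)
    (hS : S ⊆ W) (c : C(unitInterval, ℂ)) (hc0 : c 0 ∉ W) (hc : ∀ t, c t ∉ S) :
    ∃ l : ℂ → ℂ, ContinuousOn l S ∧ ∀ z ∈ S, exp (l z) = z - c 1 := by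
  obtain ⟨k, hk, hkf⟩ := exists_continuousOn_eqOn_exp_comp hW hWo (g := fun z => z - c 0)
    (by fun_prop) (by rintro ⟨z, hz, h⟩; exact hc0 (sub_eq_zero.1 h ▸ hz))
  obtain ⟨l, hl, hlf⟩ := exists_log_div_sub_of_path c hc
  refine ⟨fun z => l z + k z, hl.add (hk.mono hS), fun z hz => ?_⟩
  have hkz : exp (k z) = z - c 0 := hkf (hS hz)
  have h0 : z ≠ c 0 := ne_of_mem_of_not_mem hz (hc 0)
  rw [exp_add, hlf z hz, hkz, div_mul_cancel₀ _ (sub_ne_zero.2 h0)]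

/-- A crosscut separates a simply connected domain. -/
theorem not_isPreconnected_diff_crosscut {W : Set ℂ} (hWo : IsOpen W) (hW : IsSimplyConnected W)
    {g : ℝ → ℂ} (hg : ContinuousOn g (Set.Icc 0 1)) (hgi : Set.InjOn g (Set.Icc 0 1))
    (hgW : g '' Set.Ioo 0 1 ⊆ W) (h0 : g 0 ∉ W) (h1 : g 1 ∉ W) :
    ¬ IsPreconnected (W \ g '' Set.Ioo 0 1) := by
  intro hpre
  have s1 : Set.Icc (0 : ℝ) (1 / 2) ⊆ Set.Icc 0 1 := Set.Icc_subset_Icc_right (by norm_num)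
  have s2 : Set.Icc (1 / 2 : ℝ) 1 ⊆ Set.Icc 0 1 := Set.Icc_subset_Icc_left (by norm_num)
  have m1 (t : unitInterval) : (t : ℝ) / 2 ∈ Set.Icc (0 : ℝ) (1 / 2) :=
    ⟨by linarith [t.2.1], by linarith [t.2.2]⟩
  have m2 (t : unitInterval) : 1 - (t : ℝ) / 2 ∈ Set.Icc (1 / 2 : ℝ) 1 :=
    ⟨by linarith [t.2.2], by linarith [t.2.1]⟩
  obtain ⟨k, hk, hkf⟩ := exists_log_sub_of_path (S := W \ g '' Set.Icc 0 (1 / 2)) hWo hW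
    Set.sdiff_subset ⟨fun t => g (t / 2), hg.comp_continuous (by fun_prop) fun t => s1 (m1 t)⟩
    (by simpa) fun t ht => ht.2 ⟨_, m1 t, rfl⟩
  obtain ⟨l, hl, hlf⟩ := exists_log_sub_of_path (S := W \ g '' Set.Icc (1 / 2) 1) hWo hW
    Set.sdiff_subset ⟨fun t => g (1 - t / 2), hg.comp_continuous (by fun_prop) fun t => s2 (m2 t)⟩
    (by simpa) fun t ht => ht.2 ⟨_, m2 t, rfl⟩
  have hkf' : ∀ z ∈ W \ g '' Set.Icc 0 (1 / 2), exp (k z) = z - g (1 / 2) := by simpa using hkf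
  have hlf' : ∀ z ∈ W \ g '' Set.Icc (1 / 2) 1, exp (l z) = z - g (1 / 2) := by
    have : (1 - 1 / 2 : ℝ) = 1 / 2 := by norm_num
    simpa only [ContinuousMap.coe_mk, Set.Icc.coe_one, this] using hlf
  have hsub : (W \ g '' Set.Ioo 0 1) ⊆ W \ g '' Set.Icc 0 1 := fun z hz => ⟨hz.1, fun h => by
    rw [diff_image_Ioo_eq_compl h0 h1] at hz
    exact hz (Or.inr h)⟩
  have i1 := hsub.trans (Set.sdiff_subset_sdiff_right (Set.image_mono s1))
  have i2 := hsub.trans (Set.sdiff_subset_sdiff_right (Set.image_mono s2))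
  obtain ⟨c, hc, hkl⟩ := hpre.exists_log_eq_add_const (hk.mono i1) (hl.mono i2)
    fun z hz => by rw [hkf' z (i1 hz), hlf' z (i2 hz)]
  obtain ⟨m, hm, hmf⟩ := exists_log_union (f := fun z => z - g (1 / 2))
    (Or.inr ⟨hWo.sdiff (isClosed_arc (hg.mono s1)), hWo.sdiff (isClosed_arc (hg.mono s2))⟩)
    (l := fun z => l z + c) hk (hl.add continuousOn_const)
    (fun z hz hz' => hkl z ⟨hz.1, by
      rintro ⟨t, ht, rfl⟩
      rcases le_total t (1 / 2) with h | h
      · exact hz.2 ⟨t, ⟨ht.1.le, h⟩, rfl⟩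
      · exact hz'.2 ⟨t, ⟨h, ht.2.le⟩, rfl⟩⟩)
    hkf' fun z hz => by rw [exp_add, hc, mul_one, hlf' z hz]
  obtain ⟨r, hr, hrW⟩ := Metric.nhds_basis_closedBall.mem_iff.1
    (hWo.mem_nhds (hgW ⟨1 / 2, by norm_num, rfl⟩))
  have hsph : Metric.sphere (g (1 / 2)) r ⊆
      W \ g '' Set.Icc 0 (1 / 2) ∪ W \ g '' Set.Icc (1 / 2) 1 := by
    intro z hz
    have hzW := hrW (Metric.sphere_subset_closedBall hz)
    by_contra! h
    simp only [Set.mem_union, Set.mem_sdiff, hzW, true_and, not_or, not_not] at h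
    obtain ⟨⟨s, hs, rfl⟩, t, ht, hts⟩ := h
    obtain rfl := hgi (s2 ht) (s1 hs) hts
    obtain rfl := le_antisymm hs.2 ht.1
    exact hr.ne (by simpa using hz)
  exact not_exists_log_zpow_on_sphere hr one_ne_zero (hm.mono hsph)
    fun z hz => by rw [hmf z (hsph hz), zpow_one]

/-- A crosscut divides a bounded simply connected domain into exactly two
connected components, both of which are open. -/
theorem crosscut_two_components (W : Set ℂ)
    (hWb : Bornology.IsBounded W) (hWo : IsOpen W) (hWc : IsConnected W)
    (hWsc : SimplyConnectedSpace W) (γ : Set ℂ) (hγ : IsCrosscut W γ) :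
    ∃ U V : Set ℂ, U ≠ V ∧ IsOpen U ∧ IsOpen V ∧
      (∀ S : Set ℂ,
        (∃ x ∈ W \ γ, S = connectedComponentIn (W \ γ) x) ↔ S = U ∨ S = V) := by
  obtain ⟨g, hg, hgi, rfl, hgW, h0, h1⟩ := hγ
  rw [hWo.frontier_eq] at h0 h1
  have hFo : IsOpen (W \ g '' Set.Ioo 0 1) := by
    rw [diff_image_Ioo_eq_compl h0.2 h1.2]
    exact (hWo.isClosed_compl.union (isClosed_arc hg)).isOpen_compl
  have hsep := not_isPreconnected_diff_crosscut hWo hWsc hg hgi hgW h0.2 h1.2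
  obtain ⟨x, hx⟩ : (W \ g '' Set.Ioo 0 1).Nonempty := by
    by_contra! h
    exact hsep (h ▸ isPreconnected_empty)
  obtain ⟨y, hy, hyx⟩ :
      ∃ y ∈ W \ g '' Set.Ioo 0 1, y ∉ connectedComponentIn (W \ g '' Set.Ioo 0 1) x := by
    by_contra! h
    exact hsep ((connectedComponentIn_subset _ _).antisymm h ▸ isPreconnected_connectedComponentIn)
  refine ⟨connectedComponentIn (W \ g '' Set.Ioo 0 1) x,
    connectedComponentIn (W \ g '' Set.Ioo 0 1) y, fun h => hyx ?_,
    hFo.connectedComponentIn, hFo.connectedComponentIn, fun S => ⟨?_, ?_⟩⟩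
  · rw [h]
    exact mem_connectedComponentIn hy
  · rintro ⟨w, hw, rfl⟩
    by_contra! h
    exact not_three_components_diff_arc hWb hWo hWc hg hgi hgW h0.2 h1.2 hx hy hw hyx
      (fun hm => h.1 (connectedComponentIn_eq hm)) (fun hm => h.2 (connectedComponentIn_eq hm))
  · rintro (rfl | rfl)
    exacts [⟨x, hx, rfl⟩, ⟨y, hy, rfl⟩]
end
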